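/- Let 𝒜 be a ℂ-linear abelian category with finite-dimensional Hom spaces, M and J simple objects with M not isomorphic to J and End(M) = ℂ·id. Assume Ext¹(M, M) = 0, assume the ℂ-vector space Ext¹(J, M) is one-dimensional, and let 0 → M → D → J → 0 be a non-split short exact sequence. Then every short exact sequence 0 → M → X → D → 0 splits. -/

import Mathlib

open CategoryTheory CategoryTheory.Limits

/-- A pair of composable morphisms forming a short exact sequence `0 → A → X → B → 0`. -/
def IsSES {𝒜 : Type u} [Category.{v} 𝒜] [Abelian 𝒜] {A X B : 𝒜}
    (i : A ⟶ X) (p : X ⟶ B) : Prop :=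
  ∃ w : i ≫ p = 0, (ShortComplex.mk i p w).ShortExact

/-- A short exact sequence `0 → A → X → B → 0` splits if the monomorphism `A → X`
admits a retraction. -/
def SESSplits {𝒜 : Type u} [Category.{v} 𝒜] [Abelian 𝒜] {A X B : 𝒜}
    (i : A ⟶ X) (_p : X ⟶ B) : Prop :=
  ∃ r : X ⟶ A, i ≫ r = 𝟙 A

section

variable {𝒜 : Type u} [Category.{v} 𝒜] [Abelian 𝒜] {A X B : 𝒜} {i : A ⟶ X} {p : X ⟶ B}

theorem IsSES.comp_eq_zero (h : IsSES i p) : i ≫ p = 0 := h.choose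

theorem IsSES.mono (h : IsSES i p) : Mono i := h.choose_spec.mono_f

theorem IsSES.epi (h : IsSES i p) : Epi p := h.choose_spec.epi_g

theorem IsSES.exists_lift (h : IsSES i p) {Z : 𝒜} (f : Z ⟶ X) (hf : f ≫ p = 0) :
    ∃ g : Z ⟶ A, g ≫ i = f := by
  obtain ⟨w, hS⟩ := h
  have := hS.mono_f
  exact ⟨hS.exact.lift f hf, hS.exact.lift_f f hf⟩

theorem IsSES.exists_desc (h : IsSES i p) {Z : 𝒜} (f : X ⟶ Z) (hf : i ≫ f = 0) :
    ∃ g : B ⟶ Z, p ≫ g = f := by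
  obtain ⟨w, hS⟩ := h
  have := hS.epi_g
  exact ⟨hS.exact.desc f hf, hS.exact.g_desc f hf⟩

theorem IsSES.of_exists_lift [Mono i] [Epi p] (w : i ≫ p = 0)
    (h : ∀ (Z : 𝒜) (f : Z ⟶ X), f ≫ p = 0 → ∃ g : Z ⟶ A, g ≫ i = f) : IsSES i p := by
  refine ⟨w, ⟨ShortComplex.exact_of_f_is_kernel _ ?_⟩⟩
  exact KernelFork.IsLimit.ofι' i w fun f hf => ⟨(h _ f hf).choose, (h _ f hf).choose_spec⟩

theorem IsSES.of_exists_desc [Mono i] [Epi p] (w : i ≫ p = 0)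
    (h : ∀ (Z : 𝒜) (f : X ⟶ Z), i ≫ f = 0 → ∃ g : B ⟶ Z, p ≫ g = f) : IsSES i p := by
  refine ⟨w, ⟨ShortComplex.exact_of_g_is_cokernel _ ?_⟩⟩
  exact CokernelCofork.IsColimit.ofπ' p w fun f hf => ⟨(h _ f hf).choose, (h _ f hf).choose_spec⟩

/-- The pullback of a short exact sequence along a morphism to its last term. -/
theorem IsSES.pullback (h : IsSES i p) {C : 𝒜} (f : C ⟶ B) :
    IsSES (pullback.lift i 0 (by simp [h.comp_eq_zero]) : A ⟶ Limits.pullback p f)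
      (pullback.snd p f) := by
  have := h.mono
  have := h.epi
  have : Mono (pullback.lift i 0 (by simp [h.comp_eq_zero]) : A ⟶ Limits.pullback p f) :=
    mono_of_mono_fac (pullback.lift_fst _ _ _)
  refine IsSES.of_exists_lift (pullback.lift_snd _ _ _) fun Z g hg => ?_
  obtain ⟨k, hk⟩ := h.exists_lift (g ≫ pullback.fst p f) (by
    rw [Category.assoc, pullback.condition, reassoc_of% hg, zero_comp])
  exact ⟨k, pullback.hom_ext (by rw [Category.assoc, pullback.lift_fst, hk])
    (by rw [Category.assoc, pullback.lift_snd, hg, comp_zero])⟩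

/-- The pushout of a short exact sequence along a morphism from its first term. -/
theorem IsSES.pushout (h : IsSES i p) {C : 𝒜} (f : A ⟶ C) :
    IsSES (pushout.inr i f)
      (pushout.desc p 0 (by simp [h.comp_eq_zero]) : Limits.pushout i f ⟶ B) := by
  have := h.mono
  have := h.epi
  have : Epi (pushout.desc p 0 (by simp [h.comp_eq_zero]) : Limits.pushout i f ⟶ B) :=
    epi_of_epi_fac (pushout.inl_desc _ _ _)
  refine IsSES.of_exists_desc (pushout.inr_desc _ _ _) fun Z g hg => ?_
  obtain ⟨k, hk⟩ := h.exists_desc (pushout.inl i f ≫ g) (by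
    rw [pushout.condition_assoc, hg, comp_zero])
  exact ⟨k, pushout.hom_ext (by rw [pushout.inl_desc_assoc, hk])
    (by rw [pushout.inr_desc_assoc, hg, zero_comp])⟩

/-- If `C` is the kernel of `q`, the preimage of `C` in `X` is the kernel of `p ≫ q`. -/
theorem IsSES.pullback_fst_comp (h : IsSES i p) {C E : 𝒜} {f : C ⟶ B} {q : B ⟶ E}
    (hf : IsSES f q) : IsSES (pullback.fst p f) (p ≫ q) := by
  have := h.epi
  have := hf.mono
  have := hf.epi
  have : Epi (p ≫ q) := epi_comp p q
  refine IsSES.of_exists_lift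
    (by rw [pullback.condition_assoc, hf.comp_eq_zero, comp_zero]) fun Z g hg => ?_
  obtain ⟨k, hk⟩ := hf.exists_lift (g ≫ p) (by simpa using hg)
  exact ⟨pullback.lift g k hk.symm, pullback.lift_fst _ _ _⟩

end

/-- Let `𝒜` be a `ℂ`-linear abelian category with finite-dimensional Hom
spaces, `M` and `J` non-isomorphic simple objects with `End(M) = ℂ·id`. Assume
`Ext¹(M, M) = 0`, assume `Ext¹(J, M)` is one-dimensional, and let `0 → M → D → J → 0` be a
non-split short exact sequence. Then every short exact sequence `0 → M → X → D → 0`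
splits. -/
theorem ext_D_M_vanishes
    {𝒜 : Type u} [Category.{v} 𝒜] [Abelian 𝒜] [Linear ℂ 𝒜]
    [∀ X Y : 𝒜, FiniteDimensional ℂ (X ⟶ Y)]
    {M J : 𝒜} [Simple M] [Simple J] (hMJ : IsEmpty (M ≅ J))
    (hEndM : ∀ f : M ⟶ M, ∃ c : ℂ, f = c • 𝟙 M)
    (hExtMM : ∀ (X : 𝒜) (a : M ⟶ X) (b : X ⟶ M), IsSES a b → SESSplits a b)
    {D : 𝒜} (iD : M ⟶ D) (pD : D ⟶ J) (hD : IsSES iD pD) (hDns : ¬ SESSplits iD pD)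
    (hExtJM : ∀ (Y : 𝒜) (j : M ⟶ Y) (q : Y ⟶ J), IsSES j q →
      SESSplits j q ∨
        ∃ c : ℂ, c ≠ 0 ∧ ∃ ψ : Y ⟶ D, j ≫ ψ = iD ∧ ψ ≫ pD = q ≫ (c • 𝟙 J)) :
    ∀ (X : 𝒜) (a : M ⟶ X) (b : X ⟶ D), IsSES a b → SESSplits a b := by
  intro X a b hX
  obtain ⟨r, hr⟩ := hExtMM _ _ _ (hX.pullback iD)
  have hY := (hX.pullback_fst_comp hD).pushout r
  have ha : a ≫ pushout.inl (pullback.fst b iD) r = pushout.inr (pullback.fst b iD) r := by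
    have hw : a ≫ b = 0 ≫ iD := by simp [hX.comp_eq_zero]
    calc a ≫ pushout.inl (pullback.fst b iD) r
        = pullback.lift a 0 hw ≫ pullback.fst b iD ≫ pushout.inl (pullback.fst b iD) r := by
          rw [pullback.lift_fst_assoc]
      _ = _ := by rw [pushout.condition, reassoc_of% hr]
  obtain ⟨t, ht⟩ | ⟨c, -, ψ, hψ, hψq⟩ := hExtJM _ _ _ hY
  · exact ⟨pushout.inl _ _ ≫ t, by rw [reassoc_of% ha, ht]⟩
  · obtain ⟨g, hg⟩ := hD.exists_lift (pushout.inl _ _ ≫ ψ - c • b) (by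
      rw [Preadditive.sub_comp, Category.assoc, hψq, pushout.inl_desc_assoc]
      simp)
    have := hD.mono
    refine ⟨g, ?_⟩
    rw [← cancel_mono iD, Category.assoc, hg, Preadditive.comp_sub, reassoc_of% ha, hψ,
      Linear.comp_smul, hX.comp_eq_zero, smul_zero, sub_zero, Category.id_comp]
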